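/- Let F, G, B, R ∈ ℂ[x,y] be nonzero polynomials, let p, q be natural numbers with p + q > 0, and suppose F divides B + p·R, G divides B − q·R, and the total degrees satisfy deg B ≤ deg F + deg G and deg R ≤ deg F + deg G. Then there exist polynomials P, Q ∈ ℂ[x,y] with deg P ≤ deg F and deg Q ≤ deg G such that B = p·G·P − q·F·Q and R = −G·P − F·Q. -/

import Mathlib

open MvPolynomial

/-- Over a domain, a bound on the total degree of a product with a nonzero factor bounds the
total degree of the cofactor. -/
theorem MvPolynomial.totalDegree_le_of_totalDegree_mul_le {σ R : Type*} [CommRing R] [IsDomain R]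
    {f s : MvPolynomial σ R} {n : ℕ} (hf : f ≠ 0)
    (h : (f * s).totalDegree ≤ f.totalDegree + n) : s.totalDegree ≤ n := by
  rcases eq_or_ne s 0 with rfl | hs
  · simp
  · rw [totalDegree_mul_of_isDomain hf hs] at h
    omega

/-- Multiplication by a natural number does not increase the total degree. -/
theorem MvPolynomial.totalDegree_natCast_mul_le {σ R : Type*} [CommSemiring R]
    (n : ℕ) (f : MvPolynomial σ R) :
    ((n : MvPolynomial σ R) * f).totalDegree ≤ f.totalDegree := by
  rw [← nsmul_eq_mul]
  exact totalDegree_smul_le n f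

/-- Divisibility step with degree bounds: if `F ∣ B + p·R` and `G ∣ B − q·R` with
`p + q > 0` and `deg B, deg R ≤ deg F + deg G`, then `B = p·G·P − q·F·Q` and
`R = −G·P − F·Q` with `deg P ≤ deg F` and `deg Q ≤ deg G`. -/
theorem divisibility_step_with_degrees (F G B R : MvPolynomial (Fin 2) ℂ) (p q : ℕ)
    (hF0 : F ≠ 0) (hG0 : G ≠ 0) (hB0 : B ≠ 0) (hR0 : R ≠ 0)
    (hpq : 0 < p + q)
    (hF : F ∣ B + (p : MvPolynomial (Fin 2) ℂ) * R)
    (hG : G ∣ B - (q : MvPolynomial (Fin 2) ℂ) * R)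
    (hdB : B.totalDegree ≤ F.totalDegree + G.totalDegree)
    (hdR : R.totalDegree ≤ F.totalDegree + G.totalDegree) :
    ∃ P Q : MvPolynomial (Fin 2) ℂ,
      P.totalDegree ≤ F.totalDegree ∧ Q.totalDegree ≤ G.totalDegree ∧
      B = (p : MvPolynomial (Fin 2) ℂ) * G * P - (q : MvPolynomial (Fin 2) ℂ) * F * Q ∧
      R = -(G * P) - F * Q := by
  obtain ⟨S, hS⟩ := hF
  obtain ⟨T, hT⟩ := hG
  have hSdeg : S.totalDegree ≤ G.totalDegree := by
    apply totalDegree_le_of_totalDegree_mul_le hF0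
    rw [← hS]
    exact (totalDegree_add _ _).trans
      (max_le hdB ((totalDegree_natCast_mul_le p R).trans hdR))
  have hTdeg : T.totalDegree ≤ F.totalDegree := by
    apply totalDegree_le_of_totalDegree_mul_le hG0
    rw [← hT, add_comm G.totalDegree]
    exact (totalDegree_sub _ _).trans
      (max_le hdB ((totalDegree_natCast_mul_le q R).trans hdR))
  obtain ⟨c, hc⟩ : ∃ c : ℂ, C c * ((p : MvPolynomial (Fin 2) ℂ) + (q : MvPolynomial (Fin 2) ℂ)) = 1 := by
    have hne : ((p + q : ℕ) : ℂ) ≠ 0 := Nat.cast_ne_zero.mpr hpq.ne'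
    refine ⟨((p + q : ℕ) : ℂ)⁻¹, ?_⟩
    rw [← Nat.cast_add, ← map_natCast (C (σ := Fin 2) (R := ℂ)), ← C_mul, inv_mul_cancel₀ hne,
      C_1]
  refine ⟨c • T, (-c) • S, (totalDegree_smul_le _ _).trans hTdeg,
    (totalDegree_smul_le _ _).trans hSdeg, ?_, ?_⟩
  · rw [smul_eq_C_mul, smul_eq_C_mul, C_neg]
    linear_combination (-B) * hc + (p * C c) * hT + (q * C c) * hS
  · rw [smul_eq_C_mul, smul_eq_C_mul, C_neg]
    linear_combination (-R) * hc - C c * hT + C c * hS
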